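/- ∫_0^1 x (arctan x) / ((1+x²)(1+x)) dx = −(1/2)( (π/4) ln 2 − π²/32 − G/2 ), where G is Catalan's constant. -/

import Mathlib

open Real

/-- Catalan's constant `G = ∑_{k=0}^∞ (-1)^k / (2k+1)^2`. -/
noncomputable def catalanG : ℝ := ∑' k : ℕ, (-1 : ℝ) ^ k / (2 * (k : ℝ) + 1) ^ 2

open MeasureTheory Set

lemma intervalIntegrable_pow_mul_log (n : ℕ) (a b : ℝ) :
    IntervalIntegrable (fun x : ℝ => x ^ n * log x) volume a b :=
  intervalIntegral.intervalIntegrable_log'.continuousOn_mul (by fun_prop)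

lemma integral_pow_mul_log (n : ℕ) :
    ∫ x in (0 : ℝ)..1, x ^ n * log x = -(1 / ((n : ℝ) + 1) ^ 2) := by
  have hn : (n : ℝ) + 1 ≠ 0 := by positivity
  rw [intervalIntegral.integral_eq_sub_of_hasDerivAt_of_le zero_le_one
    (f := fun x : ℝ => x ^ n * (x * log x) / (n + 1) - x ^ (n + 1) / ((n : ℝ) + 1) ^ 2)]
  · simp
  · have := continuous_mul_log
    fun_prop
  · intro x hx
    have hx0 : x ≠ 0 := hx.1.ne'
    have h := (((hasDerivAt_pow (n + 1) x).mul (hasDerivAt_log hx0)).div_const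
      ((n : ℝ) + 1)).sub ((hasDerivAt_pow (n + 1) x).div_const (((n : ℝ) + 1) ^ 2))
    convert h using 1
    · ext y
      simp only [Pi.sub_apply, Pi.mul_apply]
      ring
    · push_cast
      field_simp
      ring
  · exact intervalIntegrable_pow_mul_log n 0 1

/-- The integral representation `G = -∫₀¹ log x / (1 + x²) dx` of Catalan's constant. -/
lemma integral_log_div_one_add_sq :
    ∫ x in (0 : ℝ)..1, log x / (1 + x ^ 2) = -catalanG := by
  have hmoment (k : ℕ) : ∫ x in Ioo (0 : ℝ) 1, x ^ (2 * k) * log x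
      = -(1 / (2 * (k : ℝ) + 1) ^ 2) := by
    rw [← integral_Ioc_eq_integral_Ioo, ← intervalIntegral.integral_of_le zero_le_one,
      integral_pow_mul_log]
    push_cast
    rfl
  have hsummable : Summable fun k : ℕ => 1 / (2 * (k : ℝ) + 1) ^ 2 := by
    have h := (summable_nat_add_iff 1).mpr
      (Real.summable_one_div_nat_pow.mpr one_lt_two)
    refine h.of_nonneg_of_le (fun k => by positivity) fun k => ?_
    push_cast
    gcongr
    linarith [(Nat.cast_nonneg k : (0 : ℝ) ≤ k)]
  have h := hasSum_integral_of_summable_integral_norm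
    (μ := volume.restrict (Ioo (0 : ℝ) 1))
    (F := fun (k : ℕ) (x : ℝ) => (-1) ^ k * (x ^ (2 * k) * log x)) ?_ ?_
  · rw [intervalIntegral.integral_of_le zero_le_one, integral_Ioc_eq_integral_Ioo, catalanG,
      ← tsum_neg]
    simp only [integral_const_mul, hmoment] at h
    rw [← setIntegral_congr_fun measurableSet_Ioo, ← h.tsum_eq]
    · exact tsum_congr fun k => by ring
    · intro x hx
      have hgeom := hasSum_geometric_of_abs_lt_one (r := -x ^ 2) (by
        rw [abs_neg, abs_of_nonneg (sq_nonneg x)]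
        nlinarith [hx.1, hx.2])
      have hsum := (hgeom.mul_right (log x)).tsum_eq
      simp only
      rw [sub_neg_eq_add, inv_mul_eq_div] at hsum
      rw [← hsum]
      refine tsum_congr fun k => ?_
      rw [neg_pow (x ^ 2), pow_mul]
      ring
  · intro k
    exact ((intervalIntegrable_iff_integrableOn_Ioo_of_le zero_le_one).mp
      (intervalIntegrable_pow_mul_log (2 * k) 0 1)).const_mul _
  · refine hsummable.congr fun k => ?_
    rw [← neg_neg (1 / _), ← hmoment k, ← integral_neg]
    refine setIntegral_congr_fun measurableSet_Ioo fun x hx => ?_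
    have hx' : x ^ (2 * k) * log x ≤ 0 :=
      mul_nonpos_of_nonneg_of_nonpos (pow_nonneg hx.1.le _) (log_nonpos hx.1.le hx.2.le)
    rw [norm_mul, norm_pow, norm_neg, norm_one, one_pow, one_mul, norm_of_nonpos hx']

lemma cos_pos_of_mem_Icc_zero_pi_div_four {θ : ℝ} (hθ : θ ∈ Icc 0 (π / 4)) : 0 < cos θ :=
  cos_pos_of_mem_Ioo ⟨by linarith [hθ.1, pi_pos], by linarith [hθ.2, pi_pos]⟩

lemma sin_nonneg_of_mem_Icc_zero_pi_div_four {θ : ℝ} (hθ : θ ∈ Icc 0 (π / 4)) : 0 ≤ sin θ :=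
  sin_nonneg_of_mem_Icc ⟨hθ.1, by linarith [hθ.2, pi_pos]⟩

lemma image_arctan_Icc_zero_one : arctan '' Icc 0 1 ⊆ Icc 0 (π / 4) := by
  rintro _ ⟨x, hx, rfl⟩
  exact ⟨arctan_nonneg.mpr hx.1, arctan_one ▸ arctan_mono hx.2⟩

lemma log_tan_eq_log_sin_sub_log_cos {θ : ℝ} (hθ : θ ∈ Icc 0 (π / 4)) :
    log (tan θ) = log (sin θ) - log (cos θ) := by
  rcases hθ.1.eq_or_lt with rfl | h
  · simp
  · rw [tan_eq_sin_div_cos, log_div (sin_pos_of_pos_of_lt_pi h (by linarith [hθ.2, pi_pos])).ne'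
      (cos_pos_of_mem_Icc_zero_pi_div_four hθ).ne']

lemma integral_log_tan_zero_pi_div_four :
    ∫ θ in (0 : ℝ)..(π / 4), log (tan θ) = -catalanG := by
  have hpi : (0 : ℝ) ≤ π / 4 := by positivity
  have h := intervalIntegral.integral_comp_mul_deriv''' (a := 0) (b := 1) (f := arctan)
    (f' := fun x => 1 / (1 + x ^ 2)) (g := fun θ => log (tan θ)) (by fun_prop)
    (fun x _ => (hasDerivAt_arctan x).hasDerivWithinAt) ?_ ?_ ?_
  · rw [arctan_zero, arctan_one] at h
    rw [← h, ← integral_log_div_one_add_sq]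
    simp [tan_arctan, div_eq_mul_inv]
  · rw [min_eq_left zero_le_one, max_eq_right zero_le_one]
    rintro _ ⟨x, hx, rfl⟩
    refine ContinuousAt.continuousWithinAt (ContinuousAt.log ?_ ?_)
    · exact continuousAt_tan.mpr (cos_arctan_pos x).ne'
    · rw [tan_arctan]
      exact hx.1.ne'
  · rw [uIcc_of_le zero_le_one]
    refine IntegrableOn.mono_set ?_ image_arctan_Icc_zero_one
    have hsc : IntervalIntegrable (fun θ => log (sin θ) - log (cos θ)) volume 0 (π / 4) :=
      intervalIntegrable_log_sin.sub intervalIntegrable_log_cos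
    rw [intervalIntegrable_iff_integrableOn_Icc_of_le hpi] at hsc
    exact hsc.congr_fun (fun θ hθ => (log_tan_eq_log_sin_sub_log_cos hθ).symm) measurableSet_Icc
  · rw [uIcc_of_le zero_le_one, ← intervalIntegrable_iff_integrableOn_Icc_of_le zero_le_one]
    simp only [Function.comp_apply, tan_arctan]
    refine intervalIntegral.intervalIntegrable_log'.mul_continuousOn
      (Continuous.continuousOn ?_)
    exact continuous_const.div (by fun_prop) fun x => by positivity

lemma integral_log_cos_zero_pi_div_four :
    ∫ θ in (0 : ℝ)..(π / 4), log (cos θ) = catalanG / 2 - π / 4 * log 2 := by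
  have hdiff : (∫ θ in (0 : ℝ)..(π / 4), log (sin θ)) - ∫ θ in (0 : ℝ)..(π / 4), log (cos θ)
      = -catalanG := by
    rw [← intervalIntegral.integral_sub (f := fun θ => log (sin θ)) (g := fun θ => log (cos θ))
      intervalIntegrable_log_sin intervalIntegrable_log_cos, ← integral_log_tan_zero_pi_div_four]
    refine intervalIntegral.integral_congr fun θ hθ => ?_
    rw [uIcc_of_le (by positivity)] at hθ
    exact (log_tan_eq_log_sin_sub_log_cos hθ).symm
  have hrefl : ∫ θ in (π / 4)..(π / 2), log (sin θ) = ∫ θ in (0 : ℝ)..(π / 4), log (cos θ) := by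
    have h := intervalIntegral.integral_comp_sub_left (a := 0) (b := π / 4)
      (fun θ => log (sin θ)) (π / 2)
    simp only [sin_pi_div_two_sub, sub_zero] at h
    rw [h]
    congr 1
    ring
  have hsum := intervalIntegral.integral_add_adjacent_intervals (μ := volume)
    (intervalIntegrable_log_sin (a := 0) (b := π / 4))
    (intervalIntegrable_log_sin (a := π / 4) (b := π / 2))
  simp only [Function.comp_apply] at hsum
  rw [hrefl, integral_log_sin_zero_pi_div_two] at hsum
  linarith

lemma sin_add_cos_eq_sqrt_two_mul_cos (θ : ℝ) : sin θ + cos θ = √2 * cos (π / 4 - θ) := by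
  rw [cos_sub, cos_pi_div_four, sin_pi_div_four]
  linear_combination (-(sin θ + cos θ) / 2) * Real.sq_sqrt (zero_le_two : (0 : ℝ) ≤ 2)

lemma integral_log_sin_add_cos_zero_pi_div_four :
    ∫ θ in (0 : ℝ)..(π / 4), log (sin θ + cos θ) = catalanG / 2 - π / 8 * log 2 := by
  have h : ∫ θ in (0 : ℝ)..(π / 4), log (sin θ + cos θ)
      = ∫ θ in (0 : ℝ)..(π / 4), (log 2 / 2 + log (cos (π / 4 - θ))) := by
    refine intervalIntegral.integral_congr fun θ hθ => ?_
    rw [uIcc_of_le (by positivity)] at hθ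
    have hc : 0 < cos (π / 4 - θ) :=
      cos_pos_of_mem_Icc_zero_pi_div_four ⟨by linarith [hθ.2], by linarith [hθ.1]⟩
    rw [sin_add_cos_eq_sqrt_two_mul_cos, log_mul (by positivity) hc.ne',
      log_sqrt zero_le_two]
  rw [h, intervalIntegral.integral_add (by simp),
    intervalIntegral.integral_comp_sub_left (fun θ => log (cos θ)), sub_self, sub_zero,
    integral_log_cos_zero_pi_div_four, intervalIntegral.integral_const, smul_eq_mul]
  · ring
  · have := (intervalIntegrable_log_cos (a := π / 4) (b := 0)).comp_sub_left (π / 4)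
    simpa using this

lemma sin_add_cos_pos_of_mem_Icc_zero_pi_div_four {θ : ℝ} (hθ : θ ∈ Icc 0 (π / 4)) :
    0 < sin θ + cos θ :=
  add_pos_of_nonneg_of_pos (sin_nonneg_of_mem_Icc_zero_pi_div_four hθ)
    (cos_pos_of_mem_Icc_zero_pi_div_four hθ)

lemma integral_mul_cos_sub_sin_div_sin_add_cos :
    ∫ θ in (0 : ℝ)..(π / 4), θ * ((cos θ - sin θ) / (sin θ + cos θ))
      = π / 4 * log 2 - catalanG / 2 := by
  have hpos {θ : ℝ} (hθ : θ ∈ uIcc 0 (π / 4)) : 0 < sin θ + cos θ :=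
    sin_add_cos_pos_of_mem_Icc_zero_pi_div_four (uIcc_of_le (by positivity : 0 ≤ π / 4) ▸ hθ)
  have hderiv (θ : ℝ) (hθ : θ ∈ uIcc 0 (π / 4)) : HasDerivAt (fun θ => log (sin θ + cos θ))
      ((cos θ - sin θ) / (sin θ + cos θ)) θ := by
    have h := ((hasDerivAt_sin θ).add (hasDerivAt_cos θ)).log (hpos hθ).ne'
    rwa [← sub_eq_add_neg] at h
  have hcont : ContinuousOn (fun θ => (cos θ - sin θ) / (sin θ + cos θ)) (uIcc 0 (π / 4)) :=
    ContinuousOn.div (by fun_prop) (by fun_prop) fun θ hθ => (hpos hθ).ne'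
  rw [intervalIntegral.integral_mul_deriv_eq_deriv_mul (u := fun θ => θ) (u' := fun _ => 1)
    (fun θ _ => hasDerivAt_id θ) hderiv (by simp) hcont.intervalIntegrable]
  simp only [one_mul]
  rw [integral_log_sin_add_cos_zero_pi_div_four, sin_add_cos_eq_sqrt_two_mul_cos, sub_self,
    cos_zero, mul_one, log_sqrt zero_le_two]
  ring

theorem stmt_13 :
    ∫ x in (0 : ℝ)..1, x * Real.arctan x / ((1 + x ^ 2) * (1 + x)) =
      -(1 / 2 * (π / 4 * Real.log 2 - π ^ 2 / 32 - catalanG / 2)) := by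
  have hpos {θ : ℝ} (hθ : θ ∈ Icc 0 (π / 4)) := sin_add_cos_pos_of_mem_Icc_zero_pi_div_four hθ
  have hu : uIcc 0 (π / 4) = Icc 0 (π / 4) := uIcc_of_le (by positivity)
  have hcont : ContinuousOn (fun θ => θ * ((cos θ - sin θ) / (sin θ + cos θ)))
      (Icc 0 (π / 4)) :=
    continuousOn_id.mul
      (ContinuousOn.div (by fun_prop) (by fun_prop) fun θ hθ => (hpos hθ).ne')
  have hsubst := intervalIntegral.integral_comp_mul_deriv'' (a := 0) (b := 1) (f := arctan)
    (f' := fun x => 1 / (1 + x ^ 2))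
    (g := fun θ => θ / 2 - 1 / 2 * (θ * ((cos θ - sin θ) / (sin θ + cos θ)))) (by fun_prop)
    (fun x _ => (hasDerivAt_arctan x).hasDerivWithinAt)
    (continuous_const.div (by fun_prop) fun x => by positivity).continuousOn
    (by
      rw [uIcc_of_le zero_le_one]
      exact (ContinuousOn.sub (by fun_prop) (continuousOn_const.mul hcont)).mono
        image_arctan_Icc_zero_one)
  rw [arctan_zero, arctan_one, intervalIntegral.integral_sub
    (Continuous.intervalIntegrable (by fun_prop) _ _)
    ((hu ▸ hcont).intervalIntegrable.const_mul _),
    intervalIntegral.integral_const_mul, integral_mul_cos_sub_sin_div_sin_add_cos,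
    intervalIntegral.integral_div, integral_id] at hsubst
  trans π ^ 2 / 64 - 1 / 2 * (π / 4 * log 2 - catalanG / 2)
  · rw [show π ^ 2 / 64 = ((π / 4) ^ 2 - 0 ^ 2) / 2 / 2 by ring, ← hsubst]
    refine intervalIntegral.integral_congr fun x hx => ?_
    rw [uIcc_of_le zero_le_one] at hx
    have hx1 : 1 + x ≠ 0 := by linarith [hx.1]
    have hx2 : 1 + x ^ 2 ≠ 0 := by positivity
    have hc := cos_arctan_pos x
    have hs : sin (arctan x) = x * cos (arctan x) := by
      rw [← tan_mul_cos hc.ne', tan_arctan]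
    simp only [Function.comp_apply]
    rw [hs, show (cos (arctan x) - x * cos (arctan x)) / (x * cos (arctan x) + cos (arctan x))
      = (1 - x) / (1 + x) by
        rw [div_eq_div_iff (by nlinarith [hx.1]) hx1]
        ring]
    field_simp
    ring
  · ring
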